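/- Let f and g be harmonic polynomials on ℝⁿ (with complex coefficients) and let f*(x) := conj(f(x)) for x ∈ ℝⁿ. Then d(f·f*) = deg f, and d(f·g) ≤ min{deg f, deg g}, where deg denotes the total degree. -/

import Mathlib

open MeasureTheory Metric MvPolynomial

noncomputable section

/-- `ℝⁿ` as a Euclidean space. -/
abbrev En (n : ℕ) : Type := EuclideanSpace ℝ (Fin n)

/-- The Laplace operator `Δ = ∂²/∂x₁² + … + ∂²/∂xₙ²` acting on polynomials. -/
def lap (n : ℕ) (P : MvPolynomial (Fin n) ℂ) : MvPolynomial (Fin n) ℂ :=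
  ∑ i : Fin n, pderiv i (pderiv i P)

/-- A polynomial is harmonic if `ΔP = 0`. -/
def IsHarmonicPoly (n : ℕ) (P : MvPolynomial (Fin n) ℂ) : Prop := lap n P = 0

/-- The polyharmonic degree `d(P) = min {N : Δ^(N+1) P = 0}`. -/
def pdeg (n : ℕ) (P : MvPolynomial (Fin n) ℂ) : ℕ := sInf {N : ℕ | (lap n)^[N + 1] P = 0}

/-- Evaluation of a polynomial at a real point of `ℝⁿ`. -/
def evalR {n : ℕ} (P : MvPolynomial (Fin n) ℂ) (x : En n) : ℂ :=
  eval (fun i => (x i : ℂ)) P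

/-- Evaluation of a polynomial at `ζθ`, i.e. after substituting `ζ θ i` for `x i`. -/
def evalC {n : ℕ} (P : MvPolynomial (Fin n) ℂ) (ζ : ℂ) (θ : En n) : ℂ :=
  eval (fun i => ζ * (θ i : ℂ)) P

/-- The surface measure on the unit sphere `S^{n-1} ⊂ ℝⁿ`. -/
def sphereMeasure (n : ℕ) : Measure (sphere (0 : En n) 1) :=
  (volume : Measure (En n)).toSphere

/-- `ω_n`, the surface area of the unit sphere `S^{n-1}`. -/
def omegaN (n : ℕ) : ℝ := ((sphereMeasure n) Set.univ).toReal

/-- The analytic continuation of `ζ ↦ r(ζθ − x)ⁿ = |ζθ − x|ⁿ` to `|ζ| > |x|`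
(principal branch; for real `ζ = ρ > |x|` it equals `|ρθ − x|ⁿ`, for `θ` on the
unit sphere). -/
def rPow (n : ℕ) (ζ : ℂ) (θ x : En n) : ℂ :=
  ζ ^ n * (1 - 2 * ((inner ℝ θ x : ℝ) : ℂ) / ζ + ((‖x‖ : ℂ)) ^ 2 / ζ ^ 2) ^ ((n : ℂ) / 2)

/-- Integral of a complex-valued function against a finite signed measure
(via the Jordan decomposition). -/
def sInt {α : Type*} [MeasurableSpace α] (μ : SignedMeasure α) (f : α → ℂ) : ℂ :=
  ∫ x, f x ∂μ.toJordanDecomposition.posPart - ∫ x, f x ∂μ.toJordanDecomposition.negPart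

/-- The support of the signed measure `μ` is contained in the set `s`. -/
def SuppIn {α : Type*} [MeasurableSpace α] (μ : SignedMeasure α) (s : Set α) : Prop :=
  μ.totalVariation sᶜ = 0

/-- The multivariate Markov transform of a finite signed measure. -/
def markov {n : ℕ} (μ : SignedMeasure (En n)) (ζ : ℂ) (θ : En n) : ℂ :=
  (omegaN n : ℂ)⁻¹ * sInt μ fun x => ζ ^ (n - 1) / rPow n ζ θ x

/-- The multivariate Markov transform of a (nonnegative) measure. -/
def markovM {n : ℕ} (μ : Measure (En n)) (ζ : ℂ) (θ : En n) : ℂ :=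
  (omegaN n : ℂ)⁻¹ * ∫ x, ζ ^ (n - 1) / rPow n ζ θ x ∂μ

/-- The function of the second kind `Q_P` for a signed measure. -/
def qP {n : ℕ} (μ : SignedMeasure (En n)) (P : MvPolynomial (Fin n) ℂ) (ζ : ℂ) (θ : En n) : ℂ :=
  (omegaN n : ℂ)⁻¹ * sInt μ fun x => (evalC P ζ θ - evalR P x) * ζ ^ (n - 1) / rPow n ζ θ x

/-- The function of the second kind `Q_P` for a (nonnegative) measure. -/
def qPM {n : ℕ} (μ : Measure (En n)) (P : MvPolynomial (Fin n) ℂ) (ζ : ℂ) (θ : En n) : ℂ :=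
  (omegaN n : ℂ)⁻¹ * ∫ x, (evalC P ζ θ - evalR P x) * ζ ^ (n - 1) / rPow n ζ θ x ∂μ

/-- The rest function `R_P` for a signed measure. -/
def restP {n : ℕ} (μ : SignedMeasure (En n)) (P : MvPolynomial (Fin n) ℂ) (ζ : ℂ) (θ : En n) : ℂ :=
  (omegaN n : ℂ)⁻¹ * sInt μ fun x => evalR P x * ζ ^ (n - 1) / rPow n ζ θ x
/-- The bilinear gradient form: `gradForm n k f g = ∑_{|I| = k} ∂_I f ∂_I g` over words `I`. -/
def gradForm (n : ℕ) : ℕ → MvPolynomial (Fin n) ℂ → MvPolynomial (Fin n) ℂ →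
    MvPolynomial (Fin n) ℂ
  | 0, f, g => f * g
  | k + 1, f, g => ∑ i : Fin n, gradForm n k (pderiv i f) (pderiv i g)

/-- The Laplacian as a linear map. -/
def lapL (n : ℕ) : MvPolynomial (Fin n) ℂ →ₗ[ℂ] MvPolynomial (Fin n) ℂ :=
  ∑ i : Fin n, (pderiv i).toLinearMap ∘ₗ (pderiv i).toLinearMap

theorem lap_eq_lapL (n : ℕ) : lap n = lapL n := by
  funext P
  simp [lap, lapL]

theorem lap_iter (n k : ℕ) (P : MvPolynomial (Fin n) ℂ) : (lap n)^[k] P = (lapL n ^ k) P := by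
  rw [lap_eq_lapL, Module.End.pow_apply]

theorem pderiv_comm_aux {n : ℕ} (i j : Fin n) (P : MvPolynomial (Fin n) ℂ) :
    pderiv i (pderiv j P) = pderiv j (pderiv i P) := by
  ext m
  simp only [coeff_pderiv, Finsupp.add_apply, add_right_comm m]
  rcases eq_or_ne i j with rfl | h
  · rfl
  · simp [Finsupp.single_eq_of_ne h, Finsupp.single_eq_of_ne h.symm]
    ring

theorem harm_pderiv {n : ℕ} {f : MvPolynomial (Fin n) ℂ} (hf : IsHarmonicPoly n f) (i : Fin n) :
    IsHarmonicPoly n (pderiv i f) := by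
  have h : lap n (pderiv i f) = pderiv i (lap n f) := by
    simp only [lap, map_sum]
    refine Finset.sum_congr rfl fun j _ => ?_
    rw [pderiv_comm_aux j i, pderiv_comm_aux j i]
  unfold IsHarmonicPoly at *
  rw [h, hf, map_zero]

theorem lap_mul {n : ℕ} {f g : MvPolynomial (Fin n) ℂ} (hf : IsHarmonicPoly n f)
    (hg : IsHarmonicPoly n g) :
    lap n (f * g) = (2 : ℂ) • ∑ i : Fin n, pderiv i f * pderiv i g := by
  have h : lap n (f * g) = lap n f * g + f * lap n g
      + (2 : ℂ) • ∑ i : Fin n, pderiv i f * pderiv i g := by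
    simp only [lap, Finset.sum_mul, Finset.mul_sum, Finset.smul_sum, ← Finset.sum_add_distrib]
    refine Finset.sum_congr rfl fun j _ => ?_
    simp only [pderiv_mul, map_add, two_smul]
    ring
  unfold IsHarmonicPoly at hf hg
  rw [h, hf, hg]
  simp

theorem lap_iter_mul {n : ℕ} (k : ℕ) : ∀ {f g : MvPolynomial (Fin n) ℂ}, IsHarmonicPoly n f →
    IsHarmonicPoly n g → (lap n)^[k] (f * g) = (2 : ℂ) ^ k • gradForm n k f g := by
  induction k with
  | zero => intro f g _ _; simp [gradForm]
  | succ k ih =>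
    intro f g hf hg
    rw [Function.iterate_succ_apply, lap_mul hf hg, lap_iter, map_smul, map_sum]
    simp only [← lap_iter, gradForm]
    rw [pow_succ', mul_smul]
    congr 1
    rw [Finset.smul_sum]
    exact Finset.sum_congr rfl fun i _ => ih (harm_pderiv hf i) (harm_pderiv hg i)

theorem gradForm_comm {n : ℕ} (k : ℕ) : ∀ f g : MvPolynomial (Fin n) ℂ,
    gradForm n k f g = gradForm n k g f := by
  induction k with
  | zero => intro f g; simp [gradForm, mul_comm]
  | succ k ih => intro f g; exact Finset.sum_congr rfl fun i _ => ih _ _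

theorem gradForm_eq_zero {n : ℕ} (k : ℕ) : ∀ f g : MvPolynomial (Fin n) ℂ,
    (∀ m : Fin n →₀ ℕ, k ≤ m.degree → coeff m f = 0) → gradForm n k f g = 0 := by
  induction k with
  | zero =>
    intro f g h
    have : f = 0 := by ext m; simpa using h m (Nat.zero_le _)
    simp [gradForm, this]
  | succ k ih =>
    intro f g h
    refine Finset.sum_eq_zero fun i _ => ih _ _ fun m hm => ?_
    rw [coeff_pderiv, h _ (by simpa using hm), zero_mul]

theorem gradForm_eq_zero_of_totalDegree {n : ℕ} (f g : MvPolynomial (Fin n) ℂ) :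
    gradForm n (f.totalDegree + 1) f g = 0 :=
  gradForm_eq_zero _ _ _ fun _ hm => coeff_eq_zero_of_totalDegree_lt hm

open scoped ComplexOrder in
theorem gradForm_star {n : ℕ} (k : ℕ) : ∀ f : MvPolynomial (Fin n) ℂ,
    0 ≤ constantCoeff (gradForm n k f (map (starRingEnd ℂ) f)) ∧
    (constantCoeff (gradForm n k f (map (starRingEnd ℂ) f)) = 0 →
      ∀ m : Fin n →₀ ℕ, m.degree = k → coeff m f = 0) := by
  induction k with
  | zero =>
    intro f
    have e : constantCoeff (gradForm n 0 f (map (starRingEnd ℂ) f))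
        = constantCoeff f * star (constantCoeff f) := by
      simp [gradForm, constantCoeff_map]
    rw [e]
    refine ⟨mul_star_self_nonneg _, fun h m hm => ?_⟩
    rw [Finsupp.degree_eq_zero_iff] at hm
    subst hm
    simpa [constantCoeff_eq] using h
  | succ k ih =>
    intro f
    simp only [gradForm, pderiv_map, map_sum]
    refine ⟨Finset.sum_nonneg fun i _ => (ih _).1, fun h m hm => ?_⟩
    rw [Finset.sum_eq_zero_iff_of_nonneg fun i _ => (ih _).1] at h
    have hm0 : m ≠ 0 := by rintro rfl; simp at hm
    obtain ⟨i, hi⟩ := Finsupp.ne_iff.mp hm0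
    have hs : m - Finsupp.single i 1 + Finsupp.single i 1 = m :=
      Finsupp.sub_add_single_one_cancel (by simpa using hi)
    have hd : (m - Finsupp.single i 1).degree = k := by
      have := congrArg Finsupp.degree hs
      rw [map_add, Finsupp.degree_single] at this
      omega
    have := (ih _).2 (h i (Finset.mem_univ _)) _ hd
    rw [coeff_pderiv, hs] at this
    exact (mul_eq_zero.mp this).resolve_right (by exact Nat.cast_add_one_ne_zero _)

theorem pdeg_mul_le_left {n : ℕ} {f g : MvPolynomial (Fin n) ℂ} (hf : IsHarmonicPoly n f)
    (hg : IsHarmonicPoly n g) : (lap n)^[f.totalDegree + 1] (f * g) = 0 := by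
  rw [lap_iter_mul _ hf hg, gradForm_eq_zero_of_totalDegree, smul_zero]

theorem harm_star {n : ℕ} {f : MvPolynomial (Fin n) ℂ} (hf : IsHarmonicPoly n f) :
    IsHarmonicPoly n (map (starRingEnd ℂ) f) := by
  have : lap n (map (starRingEnd ℂ) f) = map (starRingEnd ℂ) (lap n f) := by
    simp [lap, pderiv_map]
  unfold IsHarmonicPoly at *
  rw [this, hf, map_zero]

/-- For harmonic polynomials `f, g` (complex coefficients),
`d(f·f*) = deg f` and `d(f·g) ≤ min {deg f, deg g}`, where `f*` has conjugate
coefficients (so that `f*(x) = conj (f x)` for real `x`). -/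
theorem pdeg_mul_harmonic
    (n : ℕ) (f g : MvPolynomial (Fin n) ℂ)
    (hf : IsHarmonicPoly n f) (hg : IsHarmonicPoly n g) :
    pdeg n (f * MvPolynomial.map (starRingEnd ℂ) f) = f.totalDegree ∧
      pdeg n (f * g) ≤ min f.totalDegree g.totalDegree := by
  have hs := harm_star hf
  refine ⟨le_antisymm (Nat.sInf_le (pdeg_mul_le_left hf hs)) ?_,
    le_min (Nat.sInf_le (pdeg_mul_le_left hf hg))
      (Nat.sInf_le (by rw [mul_comm]; exact pdeg_mul_le_left hg hf))⟩
  refine le_csInf ⟨_, pdeg_mul_le_left hf hs⟩ fun N hN => ?_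
  by_contra! hlt
  have hN' : (lap n)^[N + 1] (f * map (starRingEnd ℂ) f) = 0 := hN
  have hz : (lap n)^[f.totalDegree] (f * map (starRingEnd ℂ) f) = 0 := by
    obtain ⟨c, hc⟩ := Nat.exists_eq_add_of_le (Nat.succ_le_of_lt hlt)
    rw [hc, Nat.add_comm, Function.iterate_add_apply, Nat.succ_eq_add_one, hN', lap_iter, map_zero]
  rw [lap_iter_mul _ hf hs, smul_eq_zero_iff_right (pow_ne_zero _ two_ne_zero)] at hz
  have hcoef := (gradForm_star f.totalDegree f).2 (by rw [hz, map_zero])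
  have hf0 : f ≠ 0 := by rintro rfl; simp at hlt
  obtain ⟨m, hm, hmd⟩ := Finset.exists_mem_eq_sup f.support (support_nonempty.mpr hf0)
    (fun s => s.sum fun _ e => e)
  exact mem_support_iff.mp hm (hcoef m hmd.symm)
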